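/- (Proposition 7.2: spanning quasi-triangulated subgraph implies percolating rigidity.) Consider a network with vertical-contraction boundary data gⁱ = −e₂ for i ∈ I⁺ and gⁱ = e₂ for i ∈ I⁻. Suppose: (i) I⁻ is nonempty and any two indices of I⁻ are joined by a path of neighbors lying entirely in I⁻ all of whose edges satisfy ⟨q^{ij}, e₁⟩ ≠ 0 (non-vertical); (ii) there is a sequence v₁, …, v_m of distinct indices not in I⁻ such that each v_k has at least two neighbors in I⁻ ∪ {v₁,…,v_{k−1}} for which the corresponding edge directions are linearly independent; and (iii) at least one v_k belongs to I⁺. Then the system (ns) has no solution, and hence the minimum of the nonnegative quadratic functional Q̂ over (ℝ²)^N is strictly positive. -/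

import Mathlib

noncomputable section

/-- Dot product on ℝ² (represented as `Fin 2 → ℝ`). -/
def dot (v w : Fin 2 → ℝ) : ℝ := v 0 * w 0 + v 1 * w 1

/-- First standard basis vector of ℝ². -/
def e1 : Fin 2 → ℝ := ![1, 0]

/-- Second standard basis vector of ℝ². -/
def e2 : Fin 2 → ℝ := ![0, 1]

/-- A vector orthogonal to two linearly independent vectors of the plane vanishes. -/
lemma eq_zero_of_dot_eq_zero {a b x : Fin 2 → ℝ} (hab : LinearIndependent ℝ ![a, b])
    (ha : dot x a = 0) (hb : dot x b = 0) : x = 0 := by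
  rw [LinearIndependent.pair_iff] at hab
  simp only [dot] at ha hb
  have hdet : a 0 * b 1 - a 1 * b 0 ≠ 0 := by
    intro hdet
    have h0 := hab (b 0) (-a 0) (by ext i; fin_cases i <;> simp <;> linarith)
    have h1 := hab (b 1) (-a 1) (by ext i; fin_cases i <;> simp <;> linarith)
    have h := hab 0 1 (by ext i; fin_cases i <;> simp [h0.1, h1.1])
    exact one_ne_zero h.2
  ext i
  fin_cases i
  · refine (mul_eq_zero.mp (?_ : (a 0 * b 1 - a 1 * b 0) * x 0 = 0)).resolve_left hdet
    linear_combination b 1 * ha - a 1 * hb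
  · refine (mul_eq_zero.mp (?_ : (a 0 * b 1 - a 1 * b 0) * x 1 = 0)).resolve_left hdet
    linear_combination a 0 * hb - b 0 * ha

/-- A function on `Fin (m + 1)` taking equal values at consecutive indices is constant. -/
lemma eq_apply_zero_of_castSucc_eq_succ {α : Type*} {m : ℕ} (f : Fin (m + 1) → α)
    (hf : ∀ k : Fin m, f k.castSucc = f k.succ) (k : Fin (m + 1)) : f k = f 0 := by
  induction k using Fin.induction with
  | zero => rfl
  | succ k ih => rw [← hf, ih]

/-- The weighted least-squares residual of an inconsistent linear system is bounded below by a
positive constant. -/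
lemma exists_pos_le_sum_mul_sq {ι V : Type*} [Fintype ι] [AddCommGroup V] [Module ℝ V]
    (L : V →ₗ[ℝ] ι → ℝ) (b w : ι → ℝ) (hw : ∀ k, 0 ≤ w k)
    (h : ∀ x, ∃ k, 0 < w k ∧ L x k ≠ b k) :
    ∃ c > 0, ∀ x, c ≤ ∑ k, w k * (L x k - b k) ^ 2 := by
  let D : (ι → ℝ) →ₗ[ℝ] ι → ℝ := LinearMap.pi fun k => √(w k) • LinearMap.proj k
  have hD : ∀ y k, D y k = √(w k) * y k := fun y k => rfl
  let S : Submodule ℝ (ι → ℝ) := LinearMap.range (D ∘ₗ L)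
  have hb : D b ∉ S := by
    rintro ⟨x, hx⟩
    obtain ⟨k, hk, hne⟩ := h x
    have hxk := congrFun hx k
    rw [LinearMap.comp_apply, hD, hD] at hxk
    exact hne (mul_left_cancel₀ (Real.sqrt_pos.mpr hk).ne' hxk)
  have hpos : 0 < Metric.infDist (D b) (S : Set (ι → ℝ)) :=
    (S.closed_of_finiteDimensional.notMem_iff_infDist_pos ⟨0, S.zero_mem⟩).mp hb
  refine ⟨Metric.infDist (D b) (S : Set (ι → ℝ)) ^ 2, pow_pos hpos 2, fun x => ?_⟩
  have hterm : ∀ k, w k * (L x k - b k) ^ 2 = (D b k - D (L x) k) ^ 2 := fun k => by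
    rw [hD, hD, ← mul_sub, mul_pow, Real.sq_sqrt (hw k)]
    ring
  have hsum : 0 ≤ ∑ k, w k * (L x k - b k) ^ 2 :=
    Finset.sum_nonneg fun k _ => mul_nonneg (hw k) (sq_nonneg _)
  have hdist : Metric.infDist (D b) (S : Set (ι → ℝ)) ≤ dist (D b) (D (L x)) :=
    Metric.infDist_le_dist_of_mem ⟨x, rfl⟩
  refine (Real.le_sqrt hpos.le hsum).mp (hdist.trans ?_)
  refine (dist_pi_le_iff (Real.sqrt_nonneg _)).mpr fun k => ?_
  rw [Real.dist_eq]
  refine Real.abs_le_sqrt ?_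
  rw [← hterm]
  exact Finset.single_le_sum (f := fun k => w k * (L x k - b k) ^ 2)
    (fun k _ => mul_nonneg (hw k) (sq_nonneg _)) (Finset.mem_univ k)

/-- Proposition 7.2: for vertical-contraction boundary data, a
network containing a spanning quasi-triangulated subgraph (a supported sequence
reaching I⁺) has percolating rigidity: the system (ns) has no solution and the
minimum of Q̂ is strictly positive (strong blow up of λ*). -/
theorem stmt12
    (N : ℕ)
    (adj : Fin N → Fin N → Prop) [DecidableRel adj]
    (hsymm : ∀ i j, adj i j → adj j i)
    (hirrefl : ∀ i, ¬ adj i i)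
    (q : Fin N → Fin N → Fin 2 → ℝ)
    (hq_unit : ∀ i j, adj i j → dot (q i j) (q i j) = 1)
    (hq_anti : ∀ i j, adj i j → q j i = -q i j)
    (Iplus Iminus : Finset (Fin N))
    (hdisj : Disjoint Iplus Iminus)
    (qb : Fin N → Fin 2 → ℝ)
    (hqb_plus : ∀ i ∈ Iplus, qb i = e2)
    (hqb_minus : ∀ i ∈ Iminus, qb i = -e2)
    (Csp : Fin N → Fin N → ℝ)
    (hCsp_symm : ∀ i j, Csp i j = Csp j i)
    (hCsp_pos : ∀ i j, adj i j → 0 < Csp i j)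
    (Cb : Fin N → ℝ)
    (hCb_pos : ∀ i ∈ Iplus ∪ Iminus, 0 < Cb i)
    -- vertical-contraction boundary data
    (g : Fin N → Fin 2 → ℝ)
    (hg_plus : ∀ i ∈ Iplus, g i = -e2)
    (hg_minus : ∀ i ∈ Iminus, g i = e2)
    -- (i): I⁻ nonempty and connected within I⁻ by non-vertical edges
    (hne : Iminus.Nonempty)
    (hconn : ∀ i ∈ Iminus, ∀ j ∈ Iminus, ∃ (m : ℕ) (p : Fin (m + 1) → Fin N),
      p 0 = i ∧ p (Fin.last m) = j ∧ (∀ k, p k ∈ Iminus) ∧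
      ∀ k : Fin m, adj (p k.castSucc) (p k.succ) ∧
        dot (q (p k.castSucc) (p k.succ)) e1 ≠ 0)
    -- (ii) and (iii): a supported sequence of distinct vertices outside I⁻,
    -- at least one of which lies in I⁺
    (hseq : ∃ (m : ℕ) (v : Fin m → Fin N), Function.Injective v ∧
      (∀ k, v k ∉ Iminus) ∧
      (∀ k : Fin m, ∃ j1 j2 : Fin N,
        adj (v k) j1 ∧ adj (v k) j2 ∧
        (j1 ∈ Iminus ∨ ∃ l, l < k ∧ v l = j1) ∧
        (j2 ∈ Iminus ∨ ∃ l, l < k ∧ v l = j2) ∧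
        LinearIndependent ℝ ![q (v k) j1, q (v k) j2]) ∧
      (∃ k, v k ∈ Iplus))
    (Qhat : (Fin N → Fin 2 → ℝ) → ℝ)
    (hQhat : ∀ T, Qhat T =
      (1/2) * ∑ i, ∑ j, (if adj i j then Csp i j * (dot (T i - T j) (q i j))^2 else 0)
      + ∑ i ∈ Iplus ∪ Iminus, Cb i * (dot (T i - g i) (qb i))^2) :
    (¬ ∃ T : Fin N → Fin 2 → ℝ,
      (∀ i j, adj i j → dot (T i - T j) (q i j) = 0) ∧
        (∀ i ∈ Iplus ∪ Iminus, dot (T i - g i) (qb i) = 0)) ∧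
    0 < ⨅ T : Fin N → Fin 2 → ℝ, Qhat T := by
  have hns : ¬ ∃ T : Fin N → Fin 2 → ℝ,
      (∀ i j, adj i j → dot (T i - T j) (q i j) = 0) ∧
        (∀ i ∈ Iplus ∪ Iminus, dot (T i - g i) (qb i) = 0) := by
    rintro ⟨T, hedge, hbd⟩
    obtain ⟨i₀, hi₀⟩ := hne
    obtain ⟨m, v, -, -, hsupp, k₀, hk₀⟩ := hseq
    have hminus : ∀ i ∈ Iminus, T i 1 = 1 := fun i hi => by
      have h := hbd i (Finset.mem_union_right _ hi)
      rw [hqb_minus i hi, hg_minus i hi] at h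
      simp [dot, e2] at h
      linarith
    have hplus : ∀ i ∈ Iplus, T i 1 = -1 := fun i hi => by
      have h := hbd i (Finset.mem_union_left _ hi)
      rw [hqb_plus i hi, hg_plus i hi] at h
      simp [dot, e2] at h
      linarith
    have hrigid : ∀ i ∈ Iminus, T i = T i₀ := fun i hi => by
      obtain ⟨n, p, rfl, rfl, hp, hstep⟩ := hconn i₀ hi₀ i hi
      refine eq_apply_zero_of_castSucc_eq_succ (fun k => T (p k)) (fun k => ?_) _
      obtain ⟨hadj, hq⟩ := hstep k
      have h := hedge _ _ hadj
      have h1 : T (p k.castSucc) 1 = T (p k.succ) 1 := by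
        rw [hminus _ (hp _), hminus _ (hp _)]
      simp only [dot, e1, Pi.sub_apply, h1, sub_self, zero_mul, add_zero,
        Matrix.cons_val_zero, Matrix.cons_val_one, mul_one, mul_zero] at h hq
      ext l
      fin_cases l
      · exact sub_eq_zero.mp ((mul_eq_zero.mp h).resolve_right hq)
      · exact h1
    have hv : ∀ k, T (v k) = T i₀ := fun k => by
      induction k using WellFoundedLT.induction with
      | ind k ih =>
        obtain ⟨j1, j2, ha1, ha2, hj1, hj2, hli⟩ := hsupp k
        have hknown : ∀ j, (j ∈ Iminus ∨ ∃ l, l < k ∧ v l = j) → T j = T i₀ := by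
          rintro j (hj | ⟨l, hl, rfl⟩)
          · exact hrigid j hj
          · exact ih l hl
        have h1 := hedge _ _ ha1
        have h2 := hedge _ _ ha2
        rw [hknown _ hj1] at h1
        rw [hknown _ hj2] at h2
        exact sub_eq_zero.mp (eq_zero_of_dot_eq_zero hli h1 h2)
    have h := hplus _ hk₀
    rw [hv, hminus _ hi₀] at h
    norm_num at h
  refine ⟨hns, ?_⟩
  let L : (Fin N → Fin 2 → ℝ) →ₗ[ℝ] (Fin N × Fin N) ⊕ Fin N → ℝ :=
    { toFun := fun T => Sum.elim (fun e => dot (T e.1 - T e.2) (q e.1 e.2))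
        (fun i => dot (T i) (qb i))
      map_add' := fun S T => by ext (_ | _) <;> simp [dot] <;> ring
      map_smul' := fun c T => by ext (_ | _) <;> simp [dot] <;> ring }
  let b : (Fin N × Fin N) ⊕ Fin N → ℝ := Sum.elim 0 fun i => dot (g i) (qb i)
  let w : (Fin N × Fin N) ⊕ Fin N → ℝ :=
    Sum.elim (fun e => if adj e.1 e.2 then 1 / 2 * Csp e.1 e.2 else 0)
      (fun i => if i ∈ Iplus ∪ Iminus then Cb i else 0)
  have hsub : ∀ (T : Fin N → Fin 2 → ℝ) i,
      dot (T i) (qb i) - dot (g i) (qb i) = dot (T i - g i) (qb i) := fun T i => by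
    simp only [dot, Pi.sub_apply]
    ring
  have hw : ∀ k, 0 ≤ w k := by
    rintro (⟨i, j⟩ | i)
    · by_cases hij : adj i j
      · simpa [w, hij] using (hCsp_pos i j hij).le
      · simp [w, hij]
    · by_cases hi : i ∈ Iplus ∪ Iminus
      · simpa only [w, Sum.elim_inr, if_pos hi] using (hCb_pos i hi).le
      · simp only [w, Sum.elim_inr, if_neg hi, le_refl]
  have hinc : ∀ T, ∃ k, 0 < w k ∧ L T k ≠ b k := fun T => by
    by_contra! hT
    refine hns ⟨T, fun i j hij => ?_, fun i hi => ?_⟩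
    · exact hT (Sum.inl (i, j)) (by simpa [w, hij] using hCsp_pos i j hij)
    · rw [← hsub, sub_eq_zero]
      exact hT (Sum.inr i) (by simpa only [w, Sum.elim_inr, if_pos hi] using hCb_pos i hi)
  obtain ⟨c, hc, hle⟩ := exists_pos_le_sum_mul_sq L b w hw hinc
  refine hc.trans_le (le_ciInf fun T => (hle T).trans_eq ?_)
  rw [hQhat, Fintype.sum_sum_type, Fintype.sum_prod_type, Finset.mul_sum]
  congr 1
  · refine Finset.sum_congr rfl fun i _ => ?_
    rw [Finset.mul_sum]
    refine Finset.sum_congr rfl fun j _ => ?_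
    by_cases hij : adj i j <;> simp [w, L, b, hij, mul_assoc]
  · rw [← Finset.sum_subset (Finset.subset_univ (Iplus ∪ Iminus))]
    · refine Finset.sum_congr rfl fun i hi => ?_
      simp only [w, L, b, Sum.elim_inr, if_pos hi, LinearMap.coe_mk, AddHom.coe_mk, hsub]
    · intro i _ hi
      simp only [w, Sum.elim_inr, if_neg hi, zero_mul]
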